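/- arXiv:1112.5257 — 2 statements merged into one kernel-verified Lean document; each statement's English description precedes it below -/
import Mathlib

section
/- Assume z≥1 satisfies P(Q(0)>0 and Q(z)>0)>0. Then for all k,j ∈ Cl({z}), the limit lim_{n→∞}(1/n)·log P_k(Zₙ=j) exists, is finite and nonpositive, and equals lim_{n→∞}(1/n)·log P_z(Zₙ=z). -/
open MeasureTheory ProbabilityTheory Filter Topology

noncomputable section

/-- `q` is a probability mass function on `ℕ`. -/
def IsPMF (q : ℕ → ℝ) : Prop := (∀ k, 0 ≤ q k) ∧ (∑' k, q k) = 1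

/-- Mean `m_q` of a mass function on `ℕ`. -/
def pmfMean (q : ℕ → ℝ) : ℝ := ∑' k : ℕ, (k : ℝ) * q k

/-- `X = log m_Q`. -/
def envX (q : ℕ → ℝ) : ℝ := Real.log (pmfMean q)

/-- Probability generating function of `q`. -/
def pgf (q : ℕ → ℝ) (s : ℝ) : ℝ := ∑' k, q k * s ^ k

/-- Derivative `f'` of the probability generating function of `q`. -/
def dpgf (q : ℕ → ℝ) (s : ℝ) : ℝ := ∑' k : ℕ, (k : ℝ) * q k * s ^ (k - 1)

/-- Second factorial moment `f''(1)` of `q`. -/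
def pgf2 (q : ℕ → ℝ) : ℝ := ∑' k : ℕ, (k : ℝ) * ((k : ℝ) - 1) * q k

/-- Convolution of two mass functions on `ℕ`. -/
def conv (q r : ℕ → ℝ) (k : ℕ) : ℝ := ∑ j ∈ Finset.range (k + 1), q j * r (k - j)

/-- `z`-fold convolution power `q^{*z}`. -/
def convPow (q : ℕ → ℝ) : ℕ → ℕ → ℝ
  | 0 => fun k => if k = 0 then 1 else 0
  | z + 1 => conv q (convPow q z)

/-- Quenched `n`-step transition probabilities of the branching process in the (varying)
environment `e`, where `e i` is the offspring distribution of generation `i + 1`: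
`qtrans e n k j = P(Z_n = j | Z_0 = k, environment e)`. -/
def qtrans (e : ℕ → ℕ → ℝ) : ℕ → ℕ → ℕ → ℝ
  | 0, k, j => if j = k then 1 else 0
  | n + 1, k, j => ∑' i : ℕ, qtrans e n k i * convPow (e n) i j

/-- Composition `f_{i,n} = f_{i+1} ∘ ⋯ ∘ f_n` of generating functions, where `e m` is the
offspring distribution `Q_{m+1}`. -/
def Fcomp (e : ℕ → ℕ → ℝ) (i n : ℕ) (s : ℝ) : ℝ :=
  (List.range (n - i)).foldr (fun m t => pgf (e (i + m)) t) s

/-- Extension of a finite environment to an infinite one (by a trivial environment). -/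
def extEnv (n : ℕ) (e : Fin n → ℕ → ℝ) : ℕ → ℕ → ℝ := fun i =>
  if h : i < n then e ⟨i, h⟩ else fun k => if k = 1 then 1 else 0

/-- Law of the first `n` generations of an i.i.d. environment with marginal `ν`. -/
def envPi (ν : Measure (ℕ → ℝ)) [SigmaFinite ν] (n : ℕ) :
    Measure (Fin n → ℕ → ℝ) :=
  Measure.pi fun _ : Fin n => ν

/-- Annealed probability `P_k(Z_n = j)` of the BPRE whose environment is i.i.d. with
marginal law `ν`. -/
def aP (ν : Measure (ℕ → ℝ)) [SigmaFinite ν] (n k j : ℕ) : ℝ :=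
  ∫ e, qtrans (extEnv n e) n k j ∂(envPi ν n)

/-- The set `𝓘 = {j ≥ 1 : P(Q(j) > 0, Q(0) > 0) > 0}`. -/
def Iset (ν : Measure (ℕ → ℝ)) : Set ℕ :=
  {j | 1 ≤ j ∧ 0 < ν {q | 0 < q j ∧ 0 < q 0}}

/-- The set `Cl(𝓘)` of states reachable from `𝓘`. -/
def clI (ν : Measure (ℕ → ℝ)) [SigmaFinite ν] : Set ℕ :=
  {k | 1 ≤ k ∧ ∃ n, ∃ j ∈ Iset ν, 0 < aP ν n j k}

/-- The set `Cl({z})` of states reachable from `z`. -/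
def clz (ν : Measure (ℕ → ℝ)) [SigmaFinite ν] (z : ℕ) : Set ℕ :=
  {k | 1 ≤ k ∧ ∃ n, 0 < aP ν n z k}

/-- The spine (Geiger) expectation
`E[Q_n(z₀) f_{0,n}(0)^{z₀-1} ∏_{i=1}^{n-1} f_i'(f_{i,n}(0))]`. -/
def geigerExp (ν : Measure (ℕ → ℝ)) [SigmaFinite ν] (z₀ n : ℕ) : ℝ :=
  ∫ e, (extEnv n e (n - 1)) z₀ * (Fcomp (extEnv n e) 0 n 0) ^ (z₀ - 1) *
      ∏ i ∈ Finset.Icc 1 (n - 1), dpgf (extEnv n e (i - 1)) (Fcomp (extEnv n e) i n 0)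
    ∂(envPi ν n)

/-- `Λ(0) = - log inf_{λ ≥ 0} E[e^{-λ X}]`, the rate function of `S` at `0`. -/
def Lam0 (ν : Measure (ℕ → ℝ)) : ℝ :=
  - Real.log (sInf ((fun l : ℝ => ∫ q, Real.exp (-(l * envX q)) ∂ν) '' {l : ℝ | 0 ≤ l}))

/-- Truncated standardized second moment `ξ_q(a)`. -/
def xi (q : ℕ → ℝ) (a : ℕ) : ℝ :=
  (∑' y : ℕ, if a ≤ y then (y : ℝ) ^ 2 * q y else 0) / (pmfMean q) ^ 2

/-- Assumption A2 : the random walk is non-lattice and a truncated moment condition holds. -/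
def AssumptionA2 (ν : Measure (ℕ → ℝ)) : Prop :=
  (∀ r : ℝ, 0 < r → ν {q | ∃ m : ℤ, envX q = r * m} < 1) ∧
  ∃ ε : ℝ, 0 < ε ∧ ∃ a : ℕ, ∀ x : ℝ, 0 < x →
    IntegrableOn (fun q => Real.log (max (xi q a) 1) ^ ((2 : ℝ) + ε))
      {q | -x < envX q} ν

/-- `q` has a linear fractional generating function with mean `m = pmfMean q` and
second derivative `b` at `1`. -/
def IsLF (q : ℕ → ℝ) : Prop :=
  0 < pmfMean q ∧ ∃ b : ℝ, 0 ≤ b ∧ ∀ s ∈ Set.Icc (0 : ℝ) 1,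
    pgf q s = 1 - (1 - s) / ((pmfMean q)⁻¹ + b * ((pmfMean q) ^ 2)⁻¹ * (1 - s) / 2)

/-! Helper lemmas. -/

lemma IsPMF.hasSum' {q : ℕ → ℝ} (h : IsPMF q) : HasSum q 1 := by
  have hs : Summable q := by
    by_contra hn
    have := tsum_eq_zero_of_not_summable hn
    rw [h.2] at this
    exact one_ne_zero this
  have := hs.hasSum
  rwa [h.2] at this

lemma isPMF_of_hasSum {q : ℕ → ℝ} (h0 : ∀ k, 0 ≤ q k) (h : HasSum q 1) : IsPMF q :=
  ⟨h0, h.tsum_eq⟩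

lemma isPMF_conv {q r : ℕ → ℝ} (hq : IsPMF q) (hr : IsPMF r) : IsPMF (conv q r) := by
  have h1 : Summable fun k => ‖q k‖ := hq.hasSum'.summable.norm
  have h2 : Summable fun k => ‖r k‖ := hr.hasSum'.summable.norm
  refine ⟨fun k => Finset.sum_nonneg fun j _ => mul_nonneg (hq.1 _) (hr.1 _), ?_⟩
  have := tsum_mul_tsum_eq_tsum_sum_range_of_summable_norm h1 h2
  rw [hq.2, hr.2, one_mul] at this
  exact this.symm

lemma isPMF_convPow {q : ℕ → ℝ} (hq : IsPMF q) (z : ℕ) : IsPMF (convPow q z) := by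
  induction z with
  | zero =>
    refine ⟨fun k => ?_, ?_⟩
    · simp only [convPow]; split_ifs <;> norm_num
    · simp only [convPow]; exact tsum_ite_eq 0 _
  | succ z ih => exact isPMF_conv hq ih

lemma convPow_pos {q : ℕ → ℝ} (hq : IsPMF q) {z k : ℕ} (hk : 1 ≤ k) (h0 : 0 < q 0)
    (hz : 0 < q z) : 0 < convPow q k z := by
  have hc0 : ∀ m, 0 < convPow q m 0 := by
    intro m
    induction m with
    | zero => simp [convPow]
    | succ m ih => simpa [convPow, conv] using mul_pos h0 ih
  obtain ⟨m, rfl⟩ : ∃ m, k = m + 1 := ⟨k - 1, by omega⟩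
  show 0 < ∑ j ∈ Finset.range (z + 1), q j * convPow q m (z - j)
  refine Finset.sum_pos' (fun j _ => mul_nonneg (hq.1 _) ((isPMF_convPow hq m).1 _))
    ⟨z, by simp, ?_⟩
  simpa using mul_pos hz (hc0 m)

lemma measurable_convPow (z j : ℕ) : Measurable fun q : ℕ → ℝ => convPow q z j := by
  induction z generalizing j with
  | zero => exact measurable_const
  | succ z ih =>
    show Measurable fun q : ℕ → ℝ => ∑ l ∈ Finset.range (j + 1), q l * convPow q z (j - l)
    exact Finset.measurable_sum _ fun l _ => (measurable_pi_apply l).mul (ih _)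

/-- Extended nonnegative version of `qtrans`. -/
def eT (e : ℕ → ℕ → ℝ) : ℕ → ℕ → ℕ → ENNReal
  | 0, k, j => if j = k then 1 else 0
  | n + 1, k, j => ∑' i : ℕ, eT e n k i * ENNReal.ofReal (convPow (e n) i j)

lemma measurable_eT (n k j : ℕ) : Measurable fun e : ℕ → ℕ → ℝ => eT e n k j := by
  induction n generalizing j with
  | zero => exact measurable_const
  | succ n ih =>
    show Measurable fun e : ℕ → ℕ → ℝ =>
      ∑' i : ℕ, eT e n k i * ENNReal.ofReal (convPow (e n) i j)
    refine Measurable.tsum fun i => (ih i).mul ?_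
    exact ((measurable_convPow i j).comp (measurable_pi_apply n)).ennreal_ofReal

lemma eT_congr {e e' : ℕ → ℕ → ℝ} (n k j : ℕ) (h : ∀ i < n, e i = e' i) :
    eT e n k j = eT e' n k j := by
  induction n generalizing j with
  | zero => rfl
  | succ n ih =>
    simp only [eT]
    rw [h n (by omega)]
    exact tsum_congr fun i => by rw [ih i fun l hl => h l (by omega)]

lemma eT_rowsum {e : ℕ → ℕ → ℝ} (n k : ℕ) (h : ∀ i < n, IsPMF (e i)) :
    ∑' j, eT e n k j = 1 := by
  induction n with
  | zero => simp only [eT]; exact tsum_ite_eq k _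
  | succ n ih =>
    simp only [eT]
    rw [ENNReal.tsum_comm, ← ih fun i hi => h i (by omega)]
    refine tsum_congr fun i => ?_
    have hp := isPMF_convPow (h n (by omega)) i
    rw [ENNReal.tsum_mul_left, ← ENNReal.ofReal_tsum_of_nonneg hp.1 hp.hasSum'.summable, hp.2]
    simp

lemma eT_le_one {e : ℕ → ℕ → ℝ} (n k j : ℕ) (h : ∀ i < n, IsPMF (e i)) :
    eT e n k j ≤ 1 := by
  rw [← eT_rowsum n k h]; exact ENNReal.le_tsum j

lemma qtrans_eq {e : ℕ → ℕ → ℝ} (n k j : ℕ) (h : ∀ i < n, IsPMF (e i)) :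
    qtrans e n k j = (eT e n k j).toReal := by
  induction n generalizing j with
  | zero => simp only [qtrans, eT]; split_ifs <;> simp
  | succ n ih =>
    have h' : ∀ i < n, IsPMF (e i) := fun i hi => h i (by omega)
    simp only [qtrans, eT]
    rw [ENNReal.tsum_toReal_eq]
    · refine tsum_congr fun i => ?_
      rw [ENNReal.toReal_mul, ih i h', ENNReal.toReal_ofReal]
      exact (isPMF_convPow (h n (by omega)) i).1 j
    · intro i
      exact ENNReal.mul_ne_top (ne_top_of_le_ne_top ENNReal.one_ne_top (eT_le_one n k i h'))
        ENNReal.ofReal_ne_top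

/-- One step annealed kernel. -/
def eP (ν : Measure (ℕ → ℝ)) (i j : ℕ) : ENNReal :=
  ∫⁻ q, ENNReal.ofReal (convPow q i j) ∂ν

/-- Powers of the annealed kernel. -/
def eA (ν : Measure (ℕ → ℝ)) : ℕ → ℕ → ℕ → ENNReal
  | 0, k, j => if j = k then 1 else 0
  | n + 1, k, j => ∑' i : ℕ, eA ν n k i * eP ν i j

lemma eA_add (ν : Measure (ℕ → ℝ)) (m n k j : ℕ) :
    eA ν (m + n) k j = ∑' i, eA ν m k i * eA ν n i j := by
  induction n generalizing j with
  | zero =>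
    simp only [eA, add_zero]
    rw [tsum_eq_single j]
    · simp
    · intro i hi; simp [hi.symm]
  | succ n ih =>
    rw [← add_assoc]
    simp only [eA]
    simp_rw [ih, ← ENNReal.tsum_mul_left, ← ENNReal.tsum_mul_right]
    rw [ENNReal.tsum_comm]
    simp_rw [mul_assoc]

lemma eA_add_ge (ν : Measure (ℕ → ℝ)) (m n k i j : ℕ) :
    eA ν m k i * eA ν n i j ≤ eA ν (m + n) k j := by
  rw [eA_add]; exact ENNReal.le_tsum i

lemma measurable_extEnv (n : ℕ) : Measurable (extEnv n) := by
  refine measurable_pi_lambda _ fun i => ?_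
  unfold extEnv
  by_cases h : i < n
  · simp only [h, dif_pos]; exact measurable_pi_apply _
  · simp only [h, dif_neg, not_false_iff]; exact measurable_const

lemma extEnv_last (n : ℕ) (e : Fin (n + 1) → ℕ → ℝ) :
    extEnv (n + 1) e n = e (Fin.last n) := by
  simp [extEnv, Fin.last]

lemma lintegral_eT (ν : Measure (ℕ → ℝ)) [IsProbabilityMeasure ν] (n k j : ℕ) :
    ∫⁻ e, eT (extEnv n e) n k j ∂(envPi ν n) = eA ν n k j := by
  induction n generalizing j with
  | zero => simp [eT, eA, envPi]
  | succ n ih =>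
    simp only [eT, eA]
    rw [lintegral_tsum]
    · refine tsum_congr fun i => ?_
      have hmp := measurePreserving_piFinSuccAbove (fun _ : Fin (n + 1) => ν) (Fin.last n)
      let G : (ℕ → ℝ) × (Fin n → ℕ → ℝ) → ENNReal := fun p =>
        ENNReal.ofReal (convPow p.1 i j) * eT (extEnv n p.2) n k i
      have m1 : Measurable fun q : ℕ → ℝ => ENNReal.ofReal (convPow q i j) :=
        (measurable_convPow i j).ennreal_ofReal
      have m2 : Measurable fun e : Fin n → ℕ → ℝ => eT (extEnv n e) n k i :=
        (measurable_eT n k i).comp (measurable_extEnv n)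
      have hG : Measurable G := (m1.comp measurable_fst).mul (m2.comp measurable_snd)
      have e1 := hmp.lintegral_comp hG
      have : IsProbabilityMeasure (envPi ν n) := by unfold envPi; infer_instance
      have e2 := lintegral_prod_mul (μ := ν) (ν := envPi ν n) m1.aemeasurable m2.aemeasurable
      rw [ih i] at e2
      rw [mul_comm, eP, ← e2]
      refine Eq.trans ?_ e1
      refine lintegral_congr fun e => ?_
      rw [mul_comm, extEnv_last]
      show _ = ENNReal.ofReal (convPow (e (Fin.last n)) i j) *
        eT (extEnv n fun l => e ((Fin.last n).succAbove l)) n k i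
      congr 1
      refine eT_congr _ _ _ fun l hl => ?_
      have hl' : l < n + 1 := by omega
      simp only [extEnv, hl, hl', dif_pos, Fin.succAbove_last]
      rfl
    · intro i
      refine Measurable.aemeasurable ?_
      refine ((measurable_eT n k i).comp (measurable_extEnv (n + 1))).mul ?_
      simp_rw [extEnv_last]
      exact ((measurable_convPow i j).comp (measurable_pi_apply _)).ennreal_ofReal

lemma ae_good (ν : Measure (ℕ → ℝ)) [IsProbabilityMeasure ν]
    (hpmf : ∀ᵐ q ∂ν, IsPMF q) (n : ℕ) :
    ∀ᵐ e ∂(envPi ν n), ∀ i < n, IsPMF (extEnv n e i) := by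
  have : ∀ᵐ e ∂(envPi ν n), ∀ i : Fin n, IsPMF (e i) := by
    rw [ae_all_iff]
    intro i
    exact (measurePreserving_eval (fun _ : Fin n => ν) i).quasiMeasurePreserving.ae hpmf
  filter_upwards [this] with e he i hi
  simpa [extEnv, hi] using he ⟨i, hi⟩

lemma eA_le_one (ν : Measure (ℕ → ℝ)) [IsProbabilityMeasure ν]
    (hpmf : ∀ᵐ q ∂ν, IsPMF q) (n k j : ℕ) : eA ν n k j ≤ 1 := by
  rw [← lintegral_eT]
  have : IsProbabilityMeasure (envPi ν n) := by unfold envPi; infer_instance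
  calc ∫⁻ e, eT (extEnv n e) n k j ∂(envPi ν n) ≤ ∫⁻ _, 1 ∂(envPi ν n) := by
        refine lintegral_mono_ae ?_
        filter_upwards [ae_good ν hpmf n] with e he
        exact eT_le_one n k j he
    _ = 1 := by simp

lemma aP_eq (ν : Measure (ℕ → ℝ)) [IsProbabilityMeasure ν]
    (hpmf : ∀ᵐ q ∂ν, IsPMF q) (n k j : ℕ) : aP ν n k j = (eA ν n k j).toReal := by
  rw [← lintegral_eT, ← integral_toReal]
  · refine integral_congr_ae ?_
    filter_upwards [ae_good ν hpmf n] with e he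
    exact qtrans_eq n k j he
  · exact ((measurable_eT n k j).comp (measurable_extEnv n)).aemeasurable
  · filter_upwards [ae_good ν hpmf n] with e he
    exact (eT_le_one n k j he).trans_lt ENNReal.one_lt_top

lemma aP_le_one (ν : Measure (ℕ → ℝ)) [IsProbabilityMeasure ν]
    (hpmf : ∀ᵐ q ∂ν, IsPMF q) (n k j : ℕ) : aP ν n k j ≤ 1 := by
  rw [aP_eq ν hpmf]
  exact ENNReal.toReal_le_of_le_ofReal zero_le_one (by simpa using eA_le_one ν hpmf n k j)

lemma aP_add_ge (ν : Measure (ℕ → ℝ)) [IsProbabilityMeasure ν]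
    (hpmf : ∀ᵐ q ∂ν, IsPMF q) (m n k i j : ℕ) :
    aP ν m k i * aP ν n i j ≤ aP ν (m + n) k j := by
  simp only [aP_eq ν hpmf]
  rw [← ENNReal.toReal_mul]
  exact ENNReal.toReal_mono
    (ne_top_of_le_ne_top ENNReal.one_ne_top (eA_le_one ν hpmf _ k j)) (eA_add_ge ν m n k i j)

lemma aP_one_pos (ν : Measure (ℕ → ℝ)) [IsProbabilityMeasure ν]
    (hpmf : ∀ᵐ q ∂ν, IsPMF q) (z k : ℕ) (hk : 1 ≤ k)
    (hQ : 0 < ν {q | 0 < q 0 ∧ 0 < q z}) : 0 < aP ν 1 k z := by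
  rw [aP_eq ν hpmf]
  refine ENNReal.toReal_pos ?_ (ne_top_of_le_ne_top ENNReal.one_ne_top (eA_le_one ν hpmf _ k z))
  have h1 : eA ν 1 k z = eP ν k z := by
    simp only [eA]
    rw [tsum_eq_single k]
    · simp
    · intro i hi; simp [hi]
  rw [h1, eP]
  intro h
  rw [lintegral_eq_zero_iff (measurable_convPow k z).ennreal_ofReal] at h
  refine hQ.ne' ?_
  have : ∀ᵐ q ∂ν, ¬ (0 < q 0 ∧ 0 < q z) := by
    filter_upwards [h, hpmf] with q hq hp hc
    have := convPow_pos hp hk hc.1 hc.2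
    simp only [Pi.zero_apply, ENNReal.ofReal_eq_zero] at hq
    linarith
  simpa [ae_iff] using this

/-- Lemma 5.1, first part. If `z ≥ 1` satisfies
`P(Q(0) > 0, Q(z) > 0) > 0`, then for all `k, j ∈ Cl({z})` the limit of
`(1/n) log P_k(Z_n = j)` exists, is finite and nonpositive, and equals the limit of
`(1/n) log P_z(Z_n = z)`. -/
theorem stmt1 (ν : Measure (ℕ → ℝ)) [IsProbabilityMeasure ν]
    (hpmf : ∀ᵐ q ∂ν, IsPMF q)
    (z : ℕ) (hz : 1 ≤ z)
    (hQ : 0 < ν {q | 0 < q 0 ∧ 0 < q z}) :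
    ∃ L : ℝ, L ≤ 0 ∧
      Tendsto (fun n : ℕ => (1 / (n : ℝ)) * Real.log (aP ν n z z)) atTop (𝓝 L) ∧
      ∀ k ∈ clz ν z, ∀ j ∈ clz ν z,
        Tendsto (fun n : ℕ => (1 / (n : ℝ)) * Real.log (aP ν n k j)) atTop (𝓝 L) := by
  have hmul := aP_add_ge ν hpmf
  have h1 : ∀ k, 1 ≤ k → 0 < aP ν 1 k z := fun k hk => aP_one_pos ν hpmf z k hk hQ
  have h0 : aP ν 0 z z = 1 := by rw [aP_eq ν hpmf]; simp [eA]
  have hpos : ∀ n, 0 < aP ν n z z := by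
    intro n
    induction n with
    | zero => rw [h0]; exact one_pos
    | succ n ih => exact (mul_pos ih (h1 z hz)).trans_le (hmul n 1 z z z)
  set u : ℕ → ℝ := fun n => -Real.log (aP ν n z z) with hu
  have hu0 : ∀ n, 0 ≤ u n := fun n =>
    neg_nonneg.2 (Real.log_nonpos (hpos n).le (aP_le_one ν hpmf n z z))
  have hsub : Subadditive u := by
    intro m n
    have := Real.log_le_log (mul_pos (hpos m) (hpos n)) (hmul m n z z z)
    rw [Real.log_mul (hpos m).ne' (hpos n).ne'] at this
    simp only [hu]; linarith
  have hbdd : BddBelow (Set.range fun n => u n / n) := by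
    refine ⟨0, ?_⟩
    rintro _ ⟨n, rfl⟩
    exact div_nonneg (hu0 n) n.cast_nonneg
  have hlim := hsub.tendsto_lim hbdd
  -- the shifted sequences have the same limit
  have hshift : ∀ a : ℕ, ∀ c : ℝ,
      Tendsto (fun n : ℕ => (1 / (n : ℝ)) * (Real.log (aP ν (n + a) z z) + c)) atTop
        (𝓝 (-hsub.lim)) := by
    intro a c
    have t1 : Tendsto (fun n : ℕ => u (n + a) / ((n + a : ℕ) : ℝ)) atTop (𝓝 hsub.lim) :=
      hlim.comp (tendsto_add_atTop_nat a)
    have t2 : Tendsto (fun n : ℕ => (1 : ℝ) / n) atTop (𝓝 0) :=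
      tendsto_const_div_atTop_nhds_zero_nat 1
    have t3 : Tendsto (fun n : ℕ => -(u (n + a) / ((n + a : ℕ) : ℝ)) * (1 + a * (1 / (n : ℝ)))
        + c * (1 / (n : ℝ))) atTop (𝓝 (-hsub.lim * (1 + a * 0) + c * 0)) :=
      (t1.neg.mul (tendsto_const_nhds.add (tendsto_const_nhds.mul t2))).add
        (tendsto_const_nhds.mul t2)
    simp only [mul_zero, add_zero, mul_one] at t3
    refine t3.congr' ?_
    filter_upwards [eventually_gt_atTop 0] with n hn
    have hn' : (n : ℝ) ≠ 0 := by positivity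
    have hna : (n : ℝ) + a ≠ 0 := by positivity
    simp only [hu]
    push_cast
    field_simp
  refine ⟨-hsub.lim, neg_nonpos.2 (ge_of_tendsto' hlim fun n => div_nonneg (hu0 n) n.cast_nonneg),
    by simpa using hshift 0 0, ?_⟩
  rintro k ⟨hk, a, ha⟩ j ⟨hj, b, hb⟩
  have hlow : ∀ n, aP ν 1 k z * aP ν n z z * aP ν b z j ≤ aP ν (1 + n + b) k j := fun n =>
    (mul_le_mul_of_nonneg_right (hmul 1 n k z z) hb.le).trans (hmul (1 + n) b k z j)
  have hlowpos : ∀ n, 0 < aP ν (1 + n + b) k j := fun n =>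
    (mul_pos (mul_pos (h1 k hk) (hpos n)) hb).trans_le (hlow n)
  have hup : ∀ n, aP ν a z k * aP ν n k j * aP ν 1 j z ≤ aP ν (a + n + 1) z z := fun n =>
    (mul_le_mul_of_nonneg_right (hmul a n z k j) (h1 j hj).le).trans (hmul (a + n) 1 z j z)
  -- lower bound, shifted by `1 + b`
  have hU := hshift (a + 1) (-(Real.log (aP ν a z k) + Real.log (aP ν 1 j z)))
  -- lower sequence : `aP n k j ≥ c * aP (n + 0) z z * c'` through `aP` at `n - (1 + b)`
  have hL : Tendsto (fun n : ℕ => (1 / (n : ℝ)) * (Real.log (aP ν (n - (1 + b)) z z)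
      + (Real.log (aP ν 1 k z) + Real.log (aP ν b z j)))) atTop (𝓝 (-hsub.lim)) := by
    set c := Real.log (aP ν 1 k z) + Real.log (aP ν b z j)
    rw [← tendsto_add_atTop_iff_nat (1 + b)]
    have t := hshift 0 c
    have t2 : Tendsto (fun n : ℕ => (n : ℝ) / (n + ((1 + b : ℕ) : ℝ))) atTop (𝓝 1) :=
      tendsto_natCast_div_add_atTop _
    have t3 := t.mul t2
    rw [mul_one] at t3
    refine t3.congr' ?_
    filter_upwards [eventually_gt_atTop 0] with n hn
    have hn' : (n : ℝ) ≠ 0 := by positivity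
    rw [Nat.add_sub_cancel, add_zero]
    push_cast
    have : (n : ℝ) + (1 + b) ≠ 0 := by positivity
    field_simp
  refine tendsto_of_tendsto_of_tendsto_of_le_of_le' hL hU ?_ ?_
  · filter_upwards [eventually_ge_atTop (1 + b)] with n hn
    obtain ⟨m, rfl⟩ : ∃ m, n = 1 + m + b := ⟨n - (1 + b), by omega⟩
    have e : 1 + m + b - (1 + b) = m := by omega
    rw [e]
    refine mul_le_mul_of_nonneg_left ?_ (by positivity)
    have := Real.log_le_log (mul_pos (mul_pos (h1 k hk) (hpos m)) hb) (hlow m)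
    rw [Real.log_mul (mul_pos (h1 k hk) (hpos m)).ne' hb.ne',
      Real.log_mul (h1 k hk).ne' (hpos m).ne'] at this
    linarith
  · filter_upwards [eventually_ge_atTop (1 + b)] with n hn
    have hn0 : 0 < aP ν n k j := by
      obtain ⟨m, rfl⟩ : ∃ m, n = 1 + m + b := ⟨n - (1 + b), by omega⟩
      exact hlowpos m
    refine mul_le_mul_of_nonneg_left ?_ (by positivity)
    have := Real.log_le_log (mul_pos (mul_pos ha hn0) (h1 j hj)) (hup n)
    rw [Real.log_mul (mul_pos ha hn0).ne' (h1 j hj).ne', Real.log_mul ha.ne' hn0.ne'] at this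
    have e : n + (a + 1) = a + n + 1 := by omega
    rw [e]
    linarith

end
end

section
/- Fix n≥1 and probability measures q₁,…,qₙ on ℕ₀ with probability generating functions f₁,…,fₙ, and let z₀≥1 be such that for every k∈{1,…,n}: if q_k(0)>0 then q_k(j)=0 for all 1≤j<z₀. Assume κ:=max{1≤k≤n : q_k(0)>0} exists (some q_k(0)>0). For the branching process in the varying environment (q₁,…,qₙ) started from Z₀=z₀ (i.e. given Z_{m−1}=z, Z_m has law q_m^{*z}), with the conventions f₀(s):=s^{z₀}, p_{k,m}:=1−f_{k,m}(0) for 0≤k≤m (f_{k,m}:=f_{k+1}∘⋯∘f_m), p_{−1,m}:=P_{z₀}(Z_m>0) and p_{m,m}:=1, one has P_{z₀}(Zₙ=z₀ | Zₙ>0) = (q_κ(z₀)/p_{κ−1,κ}) · ∏_{k=0}^{κ−1} (p_{k,κ}/p_{k−1,κ})·f_k′(f_{k,κ}(0)) · ∏_{j=κ+1}^{n} q_j(1)^{z₀}, provided P_{z₀}(Zₙ>0)>0. -/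
open MeasureTheory ProbabilityTheory Filter Topology

noncomputable section

lemma IsPMF.summable {q : ℕ → ℝ} (h : IsPMF q) : Summable q := by
  by_contra hc
  have h2 := h.2
  rw [tsum_eq_zero_of_not_summable hc] at h2
  norm_num at h2

lemma IsPMF.le_one {q : ℕ → ℝ} (h : IsPMF q) (k : ℕ) : q k ≤ 1 := by
  rw [← h.2]
  exact h.summable.le_tsum k (fun j _ => h.1 j)

lemma IsPMF.summable_pgf {q : ℕ → ℝ} (h : IsPMF q) {s : ℝ} (h0 : 0 ≤ s) (h1 : s ≤ 1) :
    Summable (fun k => q k * s ^ k) :=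
  Summable.of_nonneg_of_le (fun k => mul_nonneg (h.1 k) (pow_nonneg h0 k))
    (fun k => mul_le_of_le_one_right (h.1 k) (pow_le_one₀ h0 h1)) h.summable

lemma pgf_one {q : ℕ → ℝ} (h : IsPMF q) : pgf q 1 = 1 := by
  simp [pgf, h.2]

lemma pgf_zero (q : ℕ → ℝ) : pgf q 0 = q 0 := by
  unfold pgf
  rw [tsum_eq_single 0]
  · simp
  · intro k hk
    simp [hk]

lemma pgf_nonneg {q : ℕ → ℝ} (h : IsPMF q) {s : ℝ} (h0 : 0 ≤ s) : 0 ≤ pgf q s :=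
  tsum_nonneg (fun k => mul_nonneg (h.1 k) (pow_nonneg h0 k))

lemma pgf_le_one {q : ℕ → ℝ} (h : IsPMF q) {s : ℝ} (h0 : 0 ≤ s) (h1 : s ≤ 1) :
    pgf q s ≤ 1 := by
  rw [← h.2]
  exact (h.summable_pgf h0 h1).tsum_le_tsum
    (fun k => mul_le_of_le_one_right (h.1 k) (pow_le_one₀ h0 h1)) h.summable

lemma pgf_pos {q : ℕ → ℝ} (h : IsPMF q) {s : ℝ} (h0 : 0 < s) (h1 : s ≤ 1) :
    0 < pgf q s := by
  have : ∃ k, 0 < q k := by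
    by_contra hc
    push Not at hc
    have h2 := h.2
    rw [show q = fun _ => 0 from funext fun k => le_antisymm (hc k) (h.1 k)] at h2
    simp at h2
  obtain ⟨k, hk⟩ := this
  exact (h.summable_pgf h0.le h1).tsum_pos
    (fun k => mul_nonneg (h.1 k) (pow_nonneg h0.le k)) k (mul_pos hk (pow_pos h0 k))

lemma pgf_hasDerivAt {q : ℕ → ℝ} (h : IsPMF q) {s : ℝ} (h0 : 0 < s) (h1 : s < 1) :
    HasDerivAt (pgf q) (dpgf q s) s := by
  obtain ⟨r, hr1, hr2⟩ := exists_between h1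
  have hr0 : 0 < r := h0.trans hr1
  have hu : Summable (fun k : ℕ => (k : ℝ) * r ^ (k - 1)) := by
    have := summable_pow_mul_geometric_of_norm_lt_one 1 (r := r)
      (by rw [Real.norm_eq_abs, abs_of_pos hr0]; exact hr2)
    refine (this.mul_right r⁻¹).congr ?_
    intro k
    cases k with
    | zero => simp
    | succ k =>
      simp only [Nat.add_sub_cancel, pow_succ]
      field_simp
  refine hasDerivAt_tsum_of_isPreconnected (t := Set.Ioo 0 r) (y₀ := s) hu isOpen_Ioo
    isPreconnected_Ioo (g := fun k y => q k * y ^ k)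
    (g' := fun k y => (k : ℝ) * q k * y ^ (k - 1)) ?_ ?_ ⟨h0, hr1⟩
    (h.summable_pgf h0.le h1.le) ⟨h0, hr1⟩
  · intro k y _
    exact ((hasDerivAt_pow k y).const_mul (q k)).congr_deriv (by ring)
  · intro k y hy
    have hy0 : 0 ≤ y := hy.1.le
    rw [Real.norm_eq_abs, abs_of_nonneg
      (mul_nonneg (mul_nonneg (Nat.cast_nonneg k) (h.1 k)) (pow_nonneg hy0 _))]
    refine mul_le_mul (mul_le_of_le_one_right (Nat.cast_nonneg k) (h.le_one k))
      (pow_le_pow_left₀ hy0 hy.2.le _) (pow_nonneg hy0 _) (Nat.cast_nonneg k)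

lemma convPow_nonneg {q : ℕ → ℝ} (h : ∀ k, 0 ≤ q k) (z k : ℕ) : 0 ≤ convPow q z k := by
  induction z generalizing k with
  | zero => simp only [convPow]; split_ifs <;> norm_num
  | succ z ih =>
    simp only [convPow, conv]
    exact Finset.sum_nonneg fun j _ => mul_nonneg (h j) (ih _)

lemma convPow_hasSum {q : ℕ → ℝ} (h : IsPMF q) {s : ℝ} (h0 : 0 ≤ s) (h1 : s ≤ 1) (z : ℕ) :
    HasSum (fun k => convPow q z k * s ^ k) (pgf q s ^ z) := by
  induction z with
  | zero =>
    have := hasSum_single (f := fun k => convPow q 0 k * s ^ k) 0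
      (fun k hk => by simp [convPow, hk])
    simpa [convPow] using this
  | succ z ih =>
    have hf : Summable fun k => ‖q k * s ^ k‖ := (h.summable_pgf h0 h1).norm
    have hg : Summable fun k => ‖convPow q z k * s ^ k‖ := ih.summable.norm
    have := hasSum_sum_range_mul_of_summable_norm hf hg
    rw [ih.tsum_eq] at this
    rw [pow_succ']
    refine (congrArg (fun g => HasSum g _) (funext fun k => ?_)).mpr this
    simp only [convPow, conv]
    rw [Finset.sum_mul]
    refine Finset.sum_congr rfl fun j hj => ?_
    rw [Finset.mem_range] at hj
    have : s ^ k = s ^ j * s ^ (k - j) := by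
      rw [← pow_add]
      congr 1
      omega
    rw [this]
    ring

lemma qtrans_nonneg {e : ℕ → ℕ → ℝ} {m : ℕ} (h : ∀ k < m, IsPMF (e k)) (z j : ℕ) :
    0 ≤ qtrans e m z j := by
  induction m generalizing j with
  | zero => simp only [qtrans]; split_ifs <;> norm_num
  | succ m ih =>
    simp only [qtrans]
    exact tsum_nonneg fun i => mul_nonneg (ih (fun k hk => h k (by omega)) i)
      (convPow_nonneg (h m (by omega)).1 _ _)

lemma qtrans_step {e : ℕ → ℕ → ℝ} {m z : ℕ} (hm : IsPMF (qtrans e m z)) (he : IsPMF (e m))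
    {s : ℝ} (h0 : 0 ≤ s) (h1 : s ≤ 1) :
    pgf (qtrans e (m + 1) z) s = pgf (qtrans e m z) (pgf (e m) s) := by
  unfold pgf
  set A : ℕ → ℕ → ℝ := fun i j => qtrans e m z i * (convPow (e m) i j * s ^ j) with hA
  have hAs : ∀ i, HasSum (A i) (qtrans e m z i * pgf (e m) s ^ i) := fun i =>
    (convPow_hasSum he h0 h1 i).mul_left _
  have hsum : Summable (Function.uncurry A) := by
    rw [summable_prod_of_nonneg]
    · refine ⟨fun i => (hAs i).summable, ?_⟩
      refine (hm.summable_pgf (pgf_nonneg he h0) (pgf_le_one he h0 h1)).congr ?_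
      intro i
      exact (hAs i).tsum_eq.symm
    · rintro ⟨i, j⟩
      exact mul_nonneg (hm.1 i) (mul_nonneg (convPow_nonneg he.1 _ _) (pow_nonneg h0 _))
  have hc := hsum.tsum_comm
  calc ∑' j, qtrans e (m + 1) z j * s ^ j = ∑' j, ∑' i, A i j := by
        refine tsum_congr fun j => ?_
        simp only [qtrans, hA]
        rw [← tsum_mul_right]
        exact tsum_congr fun i => by ring
    _ = ∑' i, ∑' j, A i j := hc
    _ = _ := tsum_congr fun i => (hAs i).tsum_eq

lemma qtrans_isPMF {e : ℕ → ℕ → ℝ} {m : ℕ} (h : ∀ k < m, IsPMF (e k)) (z : ℕ) :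
    IsPMF (qtrans e m z) := by
  induction m with
  | zero =>
    refine ⟨qtrans_nonneg h z, ?_⟩
    simp [qtrans]
  | succ m ih =>
    refine ⟨qtrans_nonneg h z, ?_⟩
    have ihm := ih (fun k hk => h k (by omega))
    have he := h m (by omega)
    have := qtrans_step ihm he zero_le_one le_rfl
    rw [pgf_one he, pgf_one ihm] at this
    simpa [pgf] using this

lemma Fcomp_self (e : ℕ → ℕ → ℝ) (i : ℕ) (s : ℝ) : Fcomp e i i s = s := by
  simp [Fcomp]

lemma Fcomp_succ (e : ℕ → ℕ → ℝ) {i n : ℕ} (h : i ≤ n) (s : ℝ) :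
    Fcomp e i (n + 1) s = Fcomp e i n (pgf (e n) s) := by
  unfold Fcomp
  rw [show n + 1 - i = (n - i) + 1 by omega, List.range_succ, List.foldr_append]
  simp [show i + (n - i) = n by omega]

lemma Fcomp_left (e : ℕ → ℕ → ℝ) {i n : ℕ} (h : i < n) (s : ℝ) :
    Fcomp e i n s = pgf (e i) (Fcomp e (i + 1) n s) := by
  unfold Fcomp
  rw [show n - i = (n - (i + 1)) + 1 by omega, List.range_succ_eq_map]
  simp only [List.foldr_cons, List.foldr_map, add_zero, Nat.succ_eq_add_one]
  simp only [add_assoc, add_comm 1]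

lemma Fcomp_one {e : ℕ → ℕ → ℝ} {i m : ℕ} (him : i ≤ m) (h : ∀ k < m, IsPMF (e k)) :
    Fcomp e i m 1 = 1 := by
  induction m, him using Nat.le_induction with
  | base => exact Fcomp_self e i 1
  | succ m hm ih =>
    rw [Fcomp_succ e hm, pgf_one (h m (by omega))]
    exact ih (fun k hk => h k (by omega))

lemma pgf_qtrans {e : ℕ → ℕ → ℝ} {m : ℕ} (h : ∀ k < m, IsPMF (e k)) (z : ℕ)
    {s : ℝ} (h0 : 0 ≤ s) (h1 : s ≤ 1) :
    pgf (qtrans e m z) s = Fcomp e 0 m s ^ z := by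
  induction m generalizing s with
  | zero => simp [Fcomp_self, pgf, qtrans]
  | succ m ih =>
    have hh : ∀ k < m, IsPMF (e k) := fun k hk => h k (by omega)
    have he := h m (by omega)
    rw [qtrans_step (qtrans_isPMF hh z) he h0 h1, Fcomp_succ e (Nat.zero_le m),
      ih hh (pgf_nonneg he h0) (pgf_le_one he h0 h1)]

lemma dpgf_qtrans {e : ℕ → ℕ → ℝ} {m : ℕ} (h : ∀ k < m, IsPMF (e k)) (z : ℕ)
    {s : ℝ} (h0 : 0 < s) (h1 : s < 1) (hF : Fcomp e 0 m s < 1) :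
    dpgf (qtrans e m z) s = z * Fcomp e 0 m s ^ (z - 1) *
      ∏ k ∈ Finset.Icc 1 m, dpgf (e (k - 1)) (Fcomp e k m s) := by
  induction m generalizing s with
  | zero =>
    simp only [dpgf, qtrans, Fcomp_self]
    rw [tsum_eq_single z]
    · simp
    · intro k hk
      simp [hk]
  | succ m ih =>
    have hh : ∀ k < m, IsPMF (e k) := fun k hk => h k (by omega)
    have he := h m (by omega)
    rw [Fcomp_succ e (Nat.zero_le m)] at hF ⊢
    set t := pgf (e m) s with ht
    have ht0 : 0 < t := pgf_pos he h0 h1.le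
    have ht1 : t < 1 := by
      refine lt_of_le_of_ne (pgf_le_one he h0.le h1.le) fun hc => ?_
      rw [hc, Fcomp_one (Nat.zero_le m) hh] at hF
      exact lt_irrefl _ hF
    have hd1 := pgf_hasDerivAt (qtrans_isPMF h z) h0 h1
    have hd2 := (pgf_hasDerivAt (qtrans_isPMF hh z) ht0 ht1).comp s (pgf_hasDerivAt he h0 h1)
    have heq : pgf (qtrans e (m + 1) z) =ᶠ[𝓝 s] (pgf (qtrans e m z) ∘ pgf (e m)) := by
      filter_upwards [Ioo_mem_nhds h0 h1] with x hx
      exact qtrans_step (qtrans_isPMF hh z) he hx.1.le hx.2.le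
    have := hd1.unique (hd2.congr_of_eventuallyEq heq)
    rw [this, ih hh ht0 ht1 hF, Finset.prod_Icc_succ_top (by omega), Fcomp_self, ← mul_assoc]
    congr 2
    refine Finset.prod_congr rfl fun k hk => ?_
    rw [Fcomp_succ e (Finset.mem_Icc.1 hk).2]

lemma convPow_zero_right (q : ℕ → ℝ) (i : ℕ) : convPow q i 0 = q 0 ^ i := by
  induction i with
  | zero => simp [convPow]
  | succ i ih => simp [convPow, conv, ih, pow_succ']

lemma convPow_small {q : ℕ → ℝ} {z : ℕ} (h : ∀ j, 1 ≤ j → j < z → q j = 0) (i j : ℕ)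
    (hj : 1 ≤ j) (hjz : j < z) : convPow q i j = 0 := by
  induction i generalizing j with
  | zero => simp [convPow]; omega
  | succ i ih =>
    simp only [convPow, conv]
    refine Finset.sum_eq_zero fun l hl => ?_
    rw [Finset.mem_range] at hl
    rcases Nat.eq_zero_or_pos l with rfl | hl0
    · rw [Nat.sub_zero, ih j hj hjz, mul_zero]
    · rw [h l hl0 (by omega), zero_mul]

lemma convPow_at {q : ℕ → ℝ} {z : ℕ} (hz : 1 ≤ z) (h : ∀ j, 1 ≤ j → j < z → q j = 0) (i : ℕ) :
    convPow q i z = i * q 0 ^ (i - 1) * q z := by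
  induction i with
  | zero => simp [convPow]; omega
  | succ i ih =>
    simp only [convPow, conv]
    rw [Finset.sum_range_succ, Nat.sub_self, convPow_zero_right,
      Finset.sum_eq_single_of_mem 0 (by simp; omega)]
    · rw [Nat.sub_zero, ih]
      cases i with
      | zero => simp
      | succ i => simp only [Nat.add_sub_cancel]; push_cast; ring
    · intro l hl hl0
      rw [Finset.mem_range] at hl
      rw [h l (by omega) hl, zero_mul]

lemma convPow_lt {q : ℕ → ℝ} (h : q 0 = 0) (i j : ℕ) (hj : j < i) : convPow q i j = 0 := by
  induction i generalizing j with
  | zero => omega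
  | succ i ih =>
    simp only [convPow, conv]
    refine Finset.sum_eq_zero fun l hl => ?_
    rcases Nat.eq_zero_or_pos l with rfl | hl0
    · rw [h, zero_mul]
    · rw [Finset.mem_range] at hl
      rw [ih _ (by omega), mul_zero]

lemma convPow_diag {q : ℕ → ℝ} (h : q 0 = 0) (i : ℕ) : convPow q i i = q 1 ^ i := by
  induction i with
  | zero => simp [convPow]
  | succ i ih =>
    simp only [convPow, conv]
    rw [Finset.sum_eq_single_of_mem 1 (by simp)]
    · rw [Nat.add_sub_cancel, ih, pow_succ']
    · intro l hl hl1
      rcases Nat.eq_zero_or_pos l with rfl | hl0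
      · rw [h, zero_mul]
      · rw [Finset.mem_range] at hl
        rw [convPow_lt h _ _ (by omega), mul_zero]

lemma qtrans_after {q : ℕ → ℕ → ℝ} {z κ m : ℕ} (hz : 1 ≤ z) (hκm : κ ≤ m)
    (h0 : ∀ k, κ < k → k ≤ m → q k 0 = 0)
    (hs : ∀ j, 1 ≤ j → j < z → qtrans (fun j => q (j + 1)) κ z j = 0) :
    (∀ j, 1 ≤ j → j < z → qtrans (fun j => q (j + 1)) m z j = 0) ∧
    qtrans (fun j => q (j + 1)) m z 0 = qtrans (fun j => q (j + 1)) κ z 0 ∧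
    qtrans (fun j => q (j + 1)) m z z = qtrans (fun j => q (j + 1)) κ z z *
      ∏ j ∈ Finset.Icc (κ + 1) m, (q j 1) ^ z := by
  induction m, hκm using Nat.le_induction with
  | base => exact ⟨hs, rfl, by simp⟩
  | succ m hm ih =>
    obtain ⟨i1, i2, i3⟩ := ih (fun k hk hk' => h0 k hk (by omega))
    have hq0 := h0 (m + 1) (by omega) le_rfl
    refine ⟨?_, ?_, ?_⟩
    · intro j hj hjz
      simp only [qtrans]
      rw [← tsum_zero (α := ℝ) (β := ℕ)]
      refine tsum_congr fun i => ?_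
      rcases Nat.eq_zero_or_pos i with rfl | hi
      · rw [show convPow (q (m + 1)) 0 j = 0 by simp [convPow]; omega, mul_zero]
      · rcases lt_or_ge j i with hji | hji
        · rw [convPow_lt hq0 _ _ hji, mul_zero]
        · rw [i1 i hi (by omega), zero_mul]
    · simp only [qtrans]
      rw [tsum_eq_single 0, i2]
      · simp [convPow]
      · intro i hi
        rw [convPow_lt hq0 _ _ (by omega), mul_zero]
    · simp only [qtrans]
      rw [tsum_eq_single z, i3, convPow_diag hq0, Finset.prod_Icc_succ_top (by omega), mul_assoc]
      intro i hi
      rcases Nat.eq_zero_or_pos i with rfl | hi0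
      · rw [show convPow (q (m + 1)) 0 z = 0 by simp [convPow]; omega, mul_zero]
      · rcases lt_or_ge z i with hji | hji
        · rw [convPow_lt hq0 _ _ hji, mul_zero]
        · rw [i1 i hi0 (by omega), zero_mul]

/-- Lemma 4.2, Geiger decomposition in a fixed environment. For a
branching process in the fixed environment `(q 1, …, q n)` started from `z₀`, where `z₀`
is minimal in the sense that `q k 0 > 0` forces `q k j = 0` for `1 ≤ j < z₀`, and where
`κ` is the last generation whose environment allows extinction,
`P_{z₀}(Z_n = z₀ | Z_n > 0)` equals the Geiger product. Here `e j := q (j+1)`,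
`f_{k,m}(0) = Fcomp e k m 0`, `p_{k,m} = 1 - f_{k,m}(0)` and
`p_{-1,m} = P_{z₀}(Z_m > 0) = 1 - f_{0,m}(0)^{z₀}`. -/
theorem stmt9 (n : ℕ) (hn : 1 ≤ n) (q : ℕ → ℕ → ℝ)
    (hq : ∀ k ∈ Finset.Icc 1 n, IsPMF (q k))
    (z₀ : ℕ) (hz₀ : 1 ≤ z₀)
    (hmin : ∀ k ∈ Finset.Icc 1 n, 0 < q k 0 → ∀ j, 1 ≤ j → j < z₀ → q k j = 0)
    (κ : ℕ) (hκmem : κ ∈ Finset.Icc 1 n) (hκ0 : 0 < q κ 0)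
    (hκmax : ∀ k ∈ Finset.Icc 1 n, 0 < q k 0 → k ≤ κ)
    (hsurv : qtrans (fun j => q (j + 1)) n z₀ 0 < 1) :
    qtrans (fun j => q (j + 1)) n z₀ z₀ / (1 - qtrans (fun j => q (j + 1)) n z₀ 0)
      = (q κ z₀ / (1 - Fcomp (fun j => q (j + 1)) (κ - 1) κ 0))
        * (((1 - Fcomp (fun j => q (j + 1)) 0 κ 0)
              / (1 - (Fcomp (fun j => q (j + 1)) 0 κ 0) ^ z₀))
            * (z₀ : ℝ) * (Fcomp (fun j => q (j + 1)) 0 κ 0) ^ (z₀ - 1))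
        * (∏ k ∈ Finset.Icc 1 (κ - 1),
            ((1 - Fcomp (fun j => q (j + 1)) k κ 0)
                / (1 - Fcomp (fun j => q (j + 1)) (k - 1) κ 0))
              * dpgf (q k) (Fcomp (fun j => q (j + 1)) k κ 0))
        * ∏ j ∈ Finset.Icc (κ + 1) n, (q j 1) ^ z₀ := by
  obtain ⟨hκ1, hκn⟩ := Finset.mem_Icc.1 hκmem
  obtain ⟨c, rfl⟩ : ∃ c, κ = c + 1 := ⟨κ - 1, by omega⟩
  set e : ℕ → ℕ → ℝ := fun j => q (j + 1) with he
  have hpm : ∀ k < n, IsPMF (e k) := fun k hk => hq (k + 1) (Finset.mem_Icc.2 ⟨by omega, by omega⟩)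
  have hpc1 : ∀ k < c + 1, IsPMF (e k) := fun k hk => hpm k (by omega)
  have hpc : ∀ k < c, IsPMF (e k) := fun k hk => hpm k (by omega)
  have hm := hmin (c + 1) hκmem hκ0
  have hs : ∀ j, 1 ≤ j → j < z₀ → qtrans e (c + 1) z₀ j = 0 := by
    intro j hj hjz
    simp only [qtrans]
    rw [← tsum_zero (α := ℝ) (β := ℕ)]
    refine tsum_congr fun i => ?_
    rw [show convPow (e c) i j = 0 from convPow_small hm i j hj hjz, mul_zero]
  have h0 : ∀ k, c + 1 < k → k ≤ n → q k 0 = 0 := by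
    intro k hk hkn
    have hmem : k ∈ Finset.Icc 1 n := Finset.mem_Icc.2 ⟨by omega, hkn⟩
    by_contra hne
    have := hκmax k hmem (lt_of_le_of_ne ((hq k hmem).1 0) (Ne.symm hne))
    omega
  obtain ⟨-, a2, a3⟩ := qtrans_after hz₀ hκn h0 hs
  rw [a2] at hsurv
  rw [a2, a3]
  have hF0 : qtrans e (c + 1) z₀ 0 = Fcomp e 0 (c + 1) 0 ^ z₀ := by
    rw [← pgf_zero (qtrans e (c + 1) z₀), pgf_qtrans hpc1 z₀ le_rfl zero_le_one]
  rw [hF0] at hsurv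
  rw [hF0]
  -- nonvanishing
  have hne : ∀ k, k ≤ c → Fcomp e k (c + 1) 0 ≠ 1 := by
    intro k
    induction k with
    | zero =>
      intro _ hc
      rw [hc] at hsurv
      simp at hsurv
    | succ k ih =>
      intro hk hc
      apply ih (by omega)
      rw [Fcomp_left e (by omega), hc, pgf_one (hpm k (by omega))]
  have hFk : ∀ k, k ≤ c → Fcomp e k (c + 1) 0 = Fcomp e k c (q (c + 1) 0) := by
    intro k hk
    rw [Fcomp_succ e hk, pgf_zero]
  set s := q (c + 1) 0 with hsdef
  have hpκ : IsPMF (q (c + 1)) := hq _ hκmem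
  have hs1 : s < 1 := by
    refine lt_of_le_of_ne (hpκ.le_one 0) fun hc => hne c le_rfl ?_
    rw [hFk c le_rfl, Fcomp_self, hc]
  have hFlt : Fcomp e 0 c s < 1 := by
    rw [← hFk 0 (Nat.zero_le _)]
    by_contra hc
    push Not at hc
    have := one_le_pow₀ hc (n := z₀)
    linarith
  have hz : qtrans e (c + 1) z₀ z₀ = q (c + 1) z₀ * dpgf (qtrans e c z₀) s := by
    simp only [qtrans, dpgf]
    rw [← tsum_mul_left]
    refine tsum_congr fun i => ?_
    rw [show convPow (e c) i z₀ = _ from convPow_at hz₀ hm i]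
    ring
  rw [hz, dpgf_qtrans hpc z₀ hκ0 hs1 hFlt]
  have htel : ∀ d, d ≤ c → ∏ k ∈ Finset.Icc 1 d,
      ((1 - Fcomp e k (c + 1) 0) / (1 - Fcomp e (k - 1) (c + 1) 0))
      = (1 - Fcomp e d (c + 1) 0) / (1 - Fcomp e 0 (c + 1) 0) := by
    intro d
    induction d with
    | zero =>
      intro _
      have := sub_ne_zero.2 (hne 0 (Nat.zero_le _)).symm
      simp [div_self this]
    | succ d ih =>
      intro hd
      have := sub_ne_zero.2 (hne d (by omega)).symm
      have := sub_ne_zero.2 (hne 0 (Nat.zero_le _)).symm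
      rw [Finset.prod_Icc_succ_top (by omega), ih (by omega), Nat.add_sub_cancel]
      field_simp
  have hprod : ∏ k ∈ Finset.Icc 1 c, dpgf (e (k - 1)) (Fcomp e k c s)
      = ∏ k ∈ Finset.Icc 1 c, dpgf (q k) (Fcomp e k (c + 1) 0) := by
    refine Finset.prod_congr rfl fun k hk => ?_
    obtain ⟨hk1, hk2⟩ := Finset.mem_Icc.1 hk
    rw [hFk k hk2]
    simp only [he, Nat.sub_add_cancel hk1]
  rw [hprod, ← hFk 0 (Nat.zero_le _), Nat.add_sub_cancel, Finset.prod_mul_distrib, htel c le_rfl]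
  have n1 := sub_ne_zero.2 (hne 0 (Nat.zero_le _)).symm
  have n2 := sub_ne_zero.2 (hne c le_rfl).symm
  have n3 : 1 - Fcomp e 0 (c + 1) 0 ^ z₀ ≠ 0 := by linarith
  field_simp

end
end
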